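/- The radial Teukolsky equation at zero frequency, Δ^{−s}(d/dr)(Δ^{s+1} dR/dr) + (a²k² + 2ia(r−m)ks)/Δ · R − A·R = 0 with A = (l−s)(l+s+1), is transformed by the substitutions T(r) = R(r)·(r−r₊)^{iak/(r₊−r₋)}·(r−r₋)^{−iak/(r₊−r₋)} and u(ϱ) = T(ϱ(r₊−r₋) + r₋) into the hypergeometric equation ϱ(ϱ−1)u''(ϱ) + ((α+β+1)ϱ − γ)u'(ϱ) + αβ·u(ϱ) = 0 with parameters α = s − l, β = s + l + 1, γ = s + 1 + 2iak/(r₊−r₋). -/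

import Mathlib

/-- Expansion of the weighted second-order operator `Δ^{-s} (Δ^{s+1} R')'`. -/
theorem zpow_neg_mul_deriv_zpow_mul {p q r : ℝ} (hp : p < r) (hq : q < r) (s : ℤ) {F : ℝ → ℂ}
    {F' : ℂ} (hF : HasDerivAt F F' r) :
    (((r - p) * (r - q) : ℝ) : ℂ) ^ (-s) *
        deriv (fun r' : ℝ => (((r' - p) * (r' - q) : ℝ) : ℂ) ^ (s + 1) * F r') r =
      (s + 1) * (((r : ℂ) - p) + ((r : ℂ) - q)) * F r
        + ((r : ℂ) - p) * ((r : ℂ) - q) * F' := by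
  have hne : (((r - p) * (r - q) : ℝ) : ℂ) ≠ 0 := by
    exact_mod_cast (mul_pos (sub_pos.2 hp) (sub_pos.2 hq)).ne'
  have hΔ : HasDerivAt (fun r' : ℝ => (((r' - p) * (r' - q) : ℝ) : ℂ))
      ((((r - q) + (r - p) : ℝ)) : ℂ) r := by
    have := (((hasDerivAt_id r).sub_const p).mul ((hasDerivAt_id r).sub_const q)).ofReal_comp
    simpa using this
  have hz := ((hasDerivAt_zpow (s + 1) _ (Or.inl hne)).comp r hΔ).mul hF
  have hd : deriv (fun r' : ℝ => (((r' - p) * (r' - q) : ℝ) : ℂ) ^ (s + 1) * F r') r = _ :=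
    hz.deriv
  rw [hd]
  simp only [Function.comp_apply, add_sub_cancel_right]
  rw [zpow_add_one₀ hne, zpow_neg]
  have hzs := zpow_ne_zero s hne
  push_cast at hne hzs ⊢
  field_simp
  ring

/-- Derivative of a real-shifted complex power to the right of its branch point. -/
theorem hasDerivAt_ofReal_sub_cpow {p r : ℝ} (hp : p < r) (c : ℂ) :
    HasDerivAt (fun r' : ℝ => ((r' : ℂ) - p) ^ c)
      (((r : ℂ) - p) ^ c * (c / ((r : ℂ) - p))) r := by
  have hne : (r : ℂ) - p ≠ 0 := by exact_mod_cast (sub_pos.2 hp).ne'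
  have hsl : (r : ℂ) - p ∈ Complex.slitPlane := by
    rw [← Complex.ofReal_sub]
    exact Complex.ofReal_mem_slitPlane.2 (sub_pos.2 hp)
  have h : HasDerivAt (fun r' : ℝ => ((r' : ℂ) - p)) 1 r :=
    (HasDerivAt.ofReal_comp (hasDerivAt_id r)).sub_const _
  have h' := (((hasDerivAt_id ((r : ℂ) - p)).cpow_const (c := c) hsl).comp r h)
  refine h'.congr_deriv ?_
  simp only [id, Complex.cpow_sub _ _ hne, Complex.cpow_one]
  field_simp

/-- Derivative of a function multiplied by `(r - p)^c (r - q)^{-c}`. -/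
theorem HasDerivAt.mul_cpow_mul_cpow_neg {p q r : ℝ} (hp : p < r) (hq : q < r) (c : ℂ)
    {F : ℝ → ℂ} {F' : ℂ} (hF : HasDerivAt F F' r) :
    HasDerivAt (fun r' : ℝ => F r' * ((r' : ℂ) - p) ^ c * ((r' : ℂ) - q) ^ (-c))
      ((F' + c * (((r : ℂ) - p)⁻¹ - ((r : ℂ) - q)⁻¹) * F r)
        * ((r : ℂ) - p) ^ c * ((r : ℂ) - q) ^ (-c)) r := by
  refine ((hF.mul (hasDerivAt_ofReal_sub_cpow hp c)).mul
    (hasDerivAt_ofReal_sub_cpow hq (-c))).congr_deriv ?_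
  simp only [Pi.mul_apply]
  ring

/-- Derivative of a real-shifted complex inverse. -/
theorem hasDerivAt_inv_ofReal_sub {p r : ℝ} (hp : p < r) :
    HasDerivAt (fun r' : ℝ => ((r' : ℂ) - p)⁻¹) (-(((r : ℂ) - p)⁻¹) ^ 2) r := by
  have hne : (r : ℂ) - p ≠ 0 := by exact_mod_cast (sub_pos.2 hp).ne'
  have h : HasDerivAt (fun r' : ℝ => ((r' : ℂ) - p)) 1 r :=
    (HasDerivAt.ofReal_comp (hasDerivAt_id r)).sub_const _
  refine (h.inv hne).congr_deriv ?_
  field_simp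


/-- **Reduction of the zero-frequency radial Teukolsky equation to the
hypergeometric equation.** With `0 < |a| < m`, `Δ(r) = (r−r₊)(r−r₋)`,
`ν = ak/(r₊−r₋)`, the substitutions `T(r) = R(r)(r−r₊)^{iν}(r−r₋)^{−iν}` and
`u(ϱ) = T(ϱ(r₊−r₋) + r₋)` transform any solution `R` of
`Δ^{−s}(Δ^{s+1}R')' + (a²k² + 2ia(r−m)ks)/Δ·R − A·R = 0` on `(r₊, ∞)`
(`A = (l−s)(l+s+1)`) into a solution `u` on `(1, ∞)` of the hypergeometric
equation `ϱ(ϱ−1)u'' + ((α+β+1)ϱ − γ)u' + αβu = 0` with `α = s−l`, `β = s+l+1`,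
`γ = s+1+2iν`. -/
theorem radial_teukolsky_to_hypergeometric (m a : ℝ) (hm : 0 < m)
    (ha0 : a ≠ 0) (ha : |a| < m) (s k l : ℤ) (hl : |s| ≤ l)
    (R : ℝ → ℂ) :
    let rp : ℝ := m + Real.sqrt (m ^ 2 - a ^ 2)
    let rm : ℝ := m - Real.sqrt (m ^ 2 - a ^ 2)
    let Δ : ℝ → ℝ := fun r => (r - rp) * (r - rm)
    let A : ℂ := ((l - s) * (l + s + 1) : ℤ)
    let ν : ℝ := a * k / (rp - rm)
    let T : ℝ → ℂ := fun r =>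
      R r * ((r : ℂ) - rp) ^ (Complex.I * (ν : ℂ)) * ((r : ℂ) - rm) ^ (-(Complex.I * (ν : ℂ)))
    let u : ℝ → ℂ := fun ϱ => T (ϱ * (rp - rm) + rm)
    let α : ℂ := ((s - l : ℤ) : ℂ)
    let β : ℂ := ((s + l + 1 : ℤ) : ℂ)
    let γ : ℂ := ((s + 1 : ℤ) : ℂ) + 2 * Complex.I * (ν : ℂ)
    ContDiffOn ℝ 2 R (Set.Ioi rp) →
    (∀ r ∈ Set.Ioi rp,
      ((Δ r : ℂ)) ^ (-s) * deriv (fun r' => ((Δ r' : ℂ)) ^ (s + 1) * deriv R r') r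
        + (((a : ℂ) ^ 2 * (k : ℂ) ^ 2 + 2 * Complex.I * a * ((r : ℂ) - m) * k * s) / (Δ r : ℂ))
            * R r
        - A * R r = 0) →
    (∀ ϱ ∈ Set.Ioi (1 : ℝ),
      (ϱ : ℂ) * ((ϱ : ℂ) - 1) * deriv (deriv u) ϱ
        + ((α + β + 1) * (ϱ : ℂ) - γ) * deriv u ϱ + α * β * u ϱ = 0) := by
  intro rp rm Δ A ν T u α β γ hR hode ϱ hϱ
  have hϱ1 : 1 < ϱ := hϱ
  have hD : 0 < Real.sqrt (m ^ 2 - a ^ 2) :=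
    Real.sqrt_pos.2 (sub_pos.2 (sq_lt_sq' (abs_lt.1 ha).1 (abs_lt.1 ha).2))
  have hd : 0 < rp - rm := by simp only [rp, rm]; linarith
  have hm2 : m = (rp + rm) / 2 := by simp only [rp, rm]; ring
  have hν : ν * (rp - rm) = a * k := div_mul_cancel₀ _ hd.ne'
  clear_value ν rp rm
  have hd1 : ∀ r, rp < r → HasDerivAt R (deriv R r) r := fun r hr =>
    ((hR.differentiableOn (by norm_num)).differentiableAt (Ioi_mem_nhds hr)).hasDerivAt
  have hd2 : ∀ r, rp < r → HasDerivAt (deriv R) (deriv (deriv R) r) r := fun r hr =>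
    (((hR.deriv_of_isOpen (m := 1) isOpen_Ioi (by norm_num)).differentiableOn
      (by norm_num)).differentiableAt (Ioi_mem_nhds hr)).hasDerivAt
  set c : ℂ := Complex.I * (ν : ℂ) with hc
  set G : ℝ → ℂ := fun r =>
    deriv R r + c * (((r : ℂ) - rp)⁻¹ - ((r : ℂ) - rm)⁻¹) * R r with hG
  have hT1 : ∀ r, rp < r → HasDerivAt T (G r * ((r : ℂ) - rp) ^ c * ((r : ℂ) - rm) ^ (-c)) r :=
    fun r hr => (hd1 r hr).mul_cpow_mul_cpow_neg hr (by linarith) c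
  have hshift : ∀ x : ℝ, HasDerivAt (fun x : ℝ => x * (rp - rm) + rm) (rp - rm) x := fun x => by
    simpa using ((hasDerivAt_id x).mul_const (rp - rm)).add_const rm
  have hlt : ∀ x : ℝ, 1 < x → rp < x * (rp - rm) + rm := fun x hx => by nlinarith
  have hu1 : ∀ x : ℝ, 1 < x → deriv u x = (fun x : ℝ => (rp - rm) •
      (fun r : ℝ => G r * ((r : ℂ) - rp) ^ c * ((r : ℂ) - rm) ^ (-c)) (x * (rp - rm) + rm)) x :=
    fun x hx => (HasDerivAt.scomp x (hT1 _ (hlt x hx)) (hshift x)).deriv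
  set r : ℝ := ϱ * (rp - rm) + rm with hr
  have hrp : rp < r := hlt ϱ hϱ1
  have hrm : rm < r := by linarith
  have hG1 := (hd2 r hrp).add ((((hasDerivAt_inv_ofReal_sub hrp).sub
    (hasDerivAt_inv_ofReal_sub hrm)).const_mul c).mul (hd1 r hrp))
  have hu2 := ((HasDerivAt.scomp ϱ (HasDerivAt.mul_cpow_mul_cpow_neg hrp hrm c hG1)
    (hshift ϱ)).const_smul (rp - rm)).deriv
  have hu2' : deriv (deriv u) ϱ = _ :=
    (Filter.EventuallyEq.deriv_eq (Filter.eventuallyEq_of_mem (Ioi_mem_nhds hϱ1) hu1)).trans hu2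
  have hode' := hode r hrp
  rw [zpow_neg_mul_deriv_zpow_mul hrp hrm s (hd2 r hrp)] at hode'
  rw [hu2', hu1 ϱ hϱ1]
  simp only [Complex.real_smul, Pi.add_apply, Pi.mul_apply, Pi.sub_apply, ← hr, hG, u, T, Δ, A,
    α, β, γ] at hode' ⊢
  have hX : (r : ℂ) - rp ≠ 0 := by exact_mod_cast (sub_pos.2 hrp).ne'
  have hY : (r : ℂ) - rm ≠ 0 := by exact_mod_cast (sub_pos.2 hrm).ne'
  have hdc : (rp : ℂ) - rm ≠ 0 := by exact_mod_cast hd.ne'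
  have hνc : (ν : ℂ) * ((rp : ℂ) - rm) = a * k := by exact_mod_cast hν
  have hmc : (m : ℂ) = ((rp : ℂ) + rm) / 2 := by rw [hm2]; push_cast; ring
  have hϱc : (ϱ : ℂ) = ((r : ℂ) - rm) / ((rp : ℂ) - rm) := by
    rw [eq_div_iff hdc, hr]; push_cast; ring
  rw [← mul_pow, ← hνc, show 2 * Complex.I * a * ((r : ℂ) - m) * k * s =
    2 * Complex.I * (a * k) * ((r : ℂ) - m) * s by ring, ← hνc, hmc] at hode'
  generalize ((r : ℂ) - rp) ^ c = P at *
  generalize ((r : ℂ) - rm) ^ (-c) = Q at *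
  rw [hϱc]
  clear_value r
  push_cast at hode' ⊢
  generalize deriv (deriv R) r = R2 at *
  generalize deriv R r = R1 at *
  generalize R r = R0 at *
  rw [hc]
  linear_combination (norm := skip) P * Q * hode' - P * Q * R0 * ν ^ 2 * ((rp : ℂ) - rm) ^ 2
    / (((r : ℂ) - rp) * ((r : ℂ) - rm)) * Complex.I_sq
  field_simp
  ring
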